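/- Let 0 < p < 1/2 and define h(x) = −x log₂ x − (1−x) log₂(1−x) with inverse h^{-1} taking values in [0,1/2], D(x‖y) = x log₂(x/y) + (1−x) log₂((1−x)/(1−y)), δ_GV(R) = h^{-1}(1−R), ρ₀ = √p/(√p + √(1−p)), ω₀ = 2ρ₀(1−ρ₀), R_x = 1 − h(ω₀), and R_crit = 1 − h(ρ₀). Define E₀(R, p) = −δ_GV(R) log₂(2√(p(1−p))) for 0 ≤ R ≤ R_x; E₀(R, p) = D(ρ₀‖p) + R_crit − R for R_x ≤ R ≤ R_crit; and E₀(R, p) = D(δ_GV(R)‖p) for R_crit ≤ R ≤ 1 − h(p). Then for every rate R with 0 < R < 1 − h(p), the reliability function of the BSC satisfies E(R, p) ≥ E₀(R, p); that is, there exists a sequence of codes C_n ⊆ {0,1}^n with |C_n| ≥ 2^{Rn} and liminf_{n→∞} (1/n) log₂ (1/P_e(C_n, p)) ≥ E₀(R, p). -/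

import Mathlib

open Finset Filter

/-- The binary entropy function `h(x) = −x log₂ x − (1−x) log₂(1−x)`. -/
noncomputable def binEnt (x : ℝ) : ℝ :=
  -x * Real.logb 2 x - (1 - x) * Real.logb 2 (1 - x)

/-- The inverse of the binary entropy function taking values in `[0, 1/2]`. -/
noncomputable def binEntInv (y : ℝ) : ℝ :=
  sInf {x : ℝ | x ∈ Set.Icc (0 : ℝ) (1 / 2) ∧ binEnt x = y}

/-- The Gilbert–Varshamov relative distance `δ_GV(R) = h⁻¹(1−R)`. -/
noncomputable def deltaGV (R : ℝ) : ℝ := binEntInv (1 - R)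

/-- The binary Kullback–Leibler divergence
`D(x‖y) = x log₂(x/y) + (1−x) log₂((1−x)/(1−y))`. -/
noncomputable def binKL (x y : ℝ) : ℝ :=
  x * Real.logb 2 (x / y) + (1 - x) * Real.logb 2 ((1 - x) / (1 - y))

/-- `ρ₀ = √p / (√p + √(1−p))`. -/
noncomputable def rho0 (p : ℝ) : ℝ := Real.sqrt p / (Real.sqrt p + Real.sqrt (1 - p))

/-- `ω₀ = 2ρ₀(1−ρ₀)`. -/
noncomputable def omega0 (p : ℝ) : ℝ := 2 * rho0 p * (1 - rho0 p)

/-- The expurgation rate `R_x = 1 − h(ω₀)`. -/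
noncomputable def Rx (p : ℝ) : ℝ := 1 - binEnt (omega0 p)

/-- The critical rate `R_crit = 1 − h(ρ₀)`. -/
noncomputable def Rcrit (p : ℝ) : ℝ := 1 - binEnt (rho0 p)

/-- The random coding exponent `E₀(R,p)` (Elias, Gallager):
`E₀ = −δ_GV(R) log₂(2√(p(1−p)))` for `0 ≤ R ≤ R_x`,
`E₀ = D(ρ₀‖p) + R_crit − R` for `R_x ≤ R ≤ R_crit`, and
`E₀ = D(δ_GV(R)‖p)` for `R_crit ≤ R ≤ 1 − h(p)`. -/
noncomputable def E0 (p R : ℝ) : ℝ :=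
  if R ≤ Rx p then -deltaGV R * Real.logb 2 (2 * Real.sqrt (p * (1 - p)))
  else if R ≤ Rcrit p then binKL (rho0 p) p + Rcrit p - R
  else binKL (deltaGV R) p

/-- BSC transition probabilities `P(y|x) = p^{d(x,y)} (1-p)^{n-d(x,y)}`. -/
noncomputable def bscProb (n : ℕ) (p : ℝ) (x y : Fin n → Bool) : ℝ :=
  p ^ hammingDist x y * (1 - p) ^ (n - hammingDist x y)

/-- The (average) maximum-likelihood decoding error probability of a code `C`:
the minimum over all decoding maps `dec : X → C` of
`(1/|C|) ∑_{x ∈ C} ∑_{y : dec y ≠ x} P(y|x)`. -/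
noncomputable def PeCode (n : ℕ) (p : ℝ) (C : Finset (Fin n → Bool)) : ℝ :=
  sInf {e : ℝ | ∃ dec : (Fin n → Bool) → (Fin n → Bool), (∀ y, dec y ∈ C) ∧
    e = (C.card : ℝ)⁻¹ * ∑ x ∈ C,
      ∑ y ∈ Finset.univ.filter (fun y => dec y ≠ x), bscProb n p x y}

/-- The reliability function of the BSC:
`E(R,p) = limsup_{n→∞} max_{C ⊆ {0,1}ⁿ, |C| ≥ 2^{Rn}} (1/n) log₂ (1/P_e(C,p))`. -/
noncomputable def reliability (p R : ℝ) : ℝ :=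
  limsup (fun n : ℕ =>
    sSup {e : ℝ | ∃ C : Finset (Fin n → Bool),
      (2 : ℝ) ^ (R * n) ≤ (C.card : ℝ) ∧
      e = (n : ℝ)⁻¹ * Real.logb 2 (1 / PeCode n p C)}) atTop

namespace RandomCoding

/-- From any finite set one can extract `m` points whose total pairwise weight is at most the
`(m / |S|)²` fraction of the total pairwise weight of the set. -/
lemma exists_subset_sum_le {α : Type*} [DecidableEq α] (g : α → α → ℝ)
    (hg : ∀ a b, 0 ≤ g a b) (hdiag : ∀ a, g a a = 0) (S : Finset α) (m : ℕ) (hm : m ≤ S.card) :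
    ∃ C ⊆ S, C.card = m ∧
      (∑ x ∈ C, ∑ y ∈ C, g x y) * (S.card : ℝ) ^ 2
        ≤ (m : ℝ) ^ 2 * ∑ x ∈ S, ∑ y ∈ S, g x y := by
  induction hm using Nat.decreasingInduction with
  | self => exact ⟨S, Subset.rfl, rfl, (mul_comm _ _).le⟩
  | of_succ m hm ih =>
    obtain ⟨C, hCS, hC, hle⟩ := ih
    set T := ∑ x ∈ C, ∑ y ∈ C, g x y with hT
    have hT0 : 0 ≤ T := sum_nonneg fun x _ => sum_nonneg fun y _ => hg x y
    have herase : ∀ x ∈ C, ∑ a ∈ C.erase x, ∑ b ∈ C.erase x, g a b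
        = T - ∑ b ∈ C, g x b - ∑ a ∈ C, g a x := by
      intro x hx
      have h1 : ∀ a, ∑ b ∈ C.erase x, g a b = ∑ b ∈ C, g a b - g a x := fun a =>
        Finset.sum_erase_eq_sub hx
      simp only [h1]
      rw [Finset.sum_erase_eq_sub hx, sum_sub_distrib, hdiag]
      ring
    have hsum : ∑ x ∈ C, ∑ a ∈ C.erase x, ∑ b ∈ C.erase x, g a b = ((m : ℝ) + 1) * T - 2 * T := by
      rw [sum_congr rfl herase, sum_sub_distrib, sum_sub_distrib, sum_const, hC, nsmul_eq_mul,
        sum_comm (f := fun x a => g a x), ← hT]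
      push_cast
      ring
    have hne : C.Nonempty := card_pos.mp (by omega)
    obtain ⟨x, hx, hxle⟩ : ∃ x ∈ C, (∑ a ∈ C.erase x, ∑ b ∈ C.erase x, g a b) * ((m : ℝ) + 1) ^ 2
        ≤ (m : ℝ) ^ 2 * T := by
      by_contra! hcon
      have h := sum_lt_sum_of_nonempty hne hcon
      rw [sum_const, ← sum_mul, hsum, hC, nsmul_eq_mul] at h
      push_cast at h
      have : (0 : ℝ) ≤ ((m : ℝ) + 1) * T := by positivity
      nlinarith
    refine ⟨C.erase x, (erase_subset _ _).trans hCS, by rw [card_erase_of_mem hx, hC]; rfl, ?_⟩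
    push_cast at hle
    have hpos : (0 : ℝ) < ((m : ℝ) + 1) ^ 2 := by positivity
    refine le_of_mul_le_mul_right ?_ hpos
    calc _ = ((∑ a ∈ C.erase x, ∑ b ∈ C.erase x, g a b) * ((m : ℝ) + 1) ^ 2)
          * (S.card : ℝ) ^ 2 := by
          ring
      _ ≤ ((m : ℝ) ^ 2 * T) * (S.card : ℝ) ^ 2 := by gcongr
      _ = (m : ℝ) ^ 2 * (T * (S.card : ℝ) ^ 2) := by ring
      _ ≤ (m : ℝ) ^ 2 * (((m : ℝ) + 1) ^ 2 * ∑ x ∈ S, ∑ y ∈ S, g x y) := by gcongr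
      _ = _ := by ring

lemma pow_hammingDist_mul_pow {n : ℕ} (a b : ℝ) (x y : Fin n → Bool) :
    a ^ hammingDist x y * b ^ (n - hammingDist x y) = ∏ i, if x i ≠ y i then a else b := by
  have hcard : (univ.filter fun i => ¬ x i ≠ y i).card = n - hammingDist x y := by
    have h := card_filter_add_card_filter_not (s := (univ : Finset (Fin n))) (fun i => x i ≠ y i)
    rw [card_univ, Fintype.card_fin] at h
    unfold hammingDist
    omega
  rw [prod_ite, prod_const, prod_const, hcard]
  rfl

lemma sum_pow_hammingDist_mul_pow {n : ℕ} (a b : ℝ) (x : Fin n → Bool) :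
    ∑ y, a ^ hammingDist x y * b ^ (n - hammingDist x y) = (a + b) ^ n := by
  simp_rw [pow_hammingDist_mul_pow]
  rw [← Fintype.prod_sum (fun (i : Fin n) (c : Bool) => if x i ≠ c then a else b)]
  rw [Finset.prod_eq_pow_card (b := a + b), card_univ, Fintype.card_fin]
  intro i _
  cases x i <;> simp [add_comm]

lemma sum_pow_hammingDist {n : ℕ} (a : ℝ) (y : Fin n → Bool) :
    ∑ x, a ^ hammingDist x y = (1 + a) ^ n := by
  have h := sum_pow_hammingDist_mul_pow a 1 y
  simp only [one_pow, mul_one] at h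
  simp_rw [hammingDist_comm _ y]
  rw [h, add_comm]

lemma bscProb_nonneg {n : ℕ} {p : ℝ} (hp0 : 0 < p) (hp1 : p < 1) (x y : Fin n → Bool) :
    0 ≤ bscProb n p x y :=
  mul_nonneg (pow_nonneg hp0.le _) (pow_nonneg (by linarith) _)

/-- The Bhattacharyya coefficient of two output distributions of the BSC. -/
lemma sum_sqrt_bscProb {n : ℕ} {p : ℝ} (hp0 : 0 < p) (hp1 : p < 1) (x x' : Fin n → Bool) :
    ∑ y, √(bscProb n p x y * bscProb n p x' y) = (2 * √(p * (1 - p))) ^ hammingDist x x' := by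
  have hq : 0 < 1 - p := by linarith
  have h1 : ∀ y, √(bscProb n p x y * bscProb n p x' y) =
      ∏ i, (if x i ≠ y i then √p else √(1 - p)) * (if x' i ≠ y i then √p else √(1 - p)) := by
    intro y
    rw [prod_mul_distrib, ← pow_hammingDist_mul_pow, ← pow_hammingDist_mul_pow, bscProb, bscProb,
      Real.sqrt_eq_iff_mul_self_eq (by positivity) (by positivity)]
    have e : ∀ {a : ℝ}, 0 ≤ a → ∀ k : ℕ, √a ^ k * √a ^ k = a ^ k := fun ha k => by
      rw [← mul_pow, Real.mul_self_sqrt ha]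
    rw [← e hp0.le, ← e hp0.le, ← e hq.le, ← e hq.le]
    ring
  have h2 : (2 * √(p * (1 - p))) ^ hammingDist x x' =
      ∏ i, if x i ≠ x' i then 2 * √(p * (1 - p)) else 1 := by
    rw [← pow_hammingDist_mul_pow, one_pow, mul_one]
  simp_rw [h1]
  rw [← Fintype.prod_sum (fun (i : Fin n) (c : Bool) =>
    (if x i ≠ c then √p else √(1 - p)) * (if x' i ≠ c then √p else √(1 - p))), h2]
  refine prod_congr rfl fun i _ => ?_
  rw [Real.sqrt_mul hp0.le]
  have e1 : √p * √p = p := Real.mul_self_sqrt hp0.le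
  have e2 : √(1 - p) * √(1 - p) = 1 - p := Real.mul_self_sqrt hq.le
  cases x i <;> cases x' i <;> simp [e1, e2] <;> ring

/-- Minimum distance decoding bound on the error probability. -/
lemma PeCode_le {n : ℕ} {p : ℝ} (hp0 : 0 < p) (hp1 : p < 1) {C : Finset (Fin n → Bool)}
    (hC : C.Nonempty) :
    PeCode n p C ≤ (C.card : ℝ)⁻¹ * ∑ x ∈ C, ∑ y ∈ univ.filter
      (fun y => ∃ x' ∈ C, x' ≠ x ∧ hammingDist x' y ≤ hammingDist x y), bscProb n p x y := by
  choose dec hdec hmin using fun y => C.exists_min_image (fun x => hammingDist x y) hC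
  have hbdd : ∀ e ∈ {e : ℝ | ∃ dec : (Fin n → Bool) → (Fin n → Bool), (∀ y, dec y ∈ C) ∧
      e = (C.card : ℝ)⁻¹ * ∑ x ∈ C, ∑ y ∈ univ.filter (fun y => dec y ≠ x), bscProb n p x y},
      0 ≤ e := by
    rintro _ ⟨d, -, rfl⟩
    exact mul_nonneg (by positivity)
      (sum_nonneg fun x _ => sum_nonneg fun y _ => bscProb_nonneg hp0 hp1 x y)
  refine (csInf_le ⟨0, hbdd⟩ ⟨dec, hdec, rfl⟩).trans ?_
  refine mul_le_mul_of_nonneg_left (sum_le_sum fun x hx => ?_) (by positivity)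
  refine sum_le_sum_of_subset_of_nonneg (fun y hy => ?_) fun y _ _ => bscProb_nonneg hp0 hp1 x y
  rw [mem_filter] at hy ⊢
  exact ⟨mem_univ _, dec y, hdec y, hy.2, hmin y x hx⟩

lemma le_PeCode {n : ℕ} {p : ℝ} (hp0 : 0 < p) (hp : p < 1 / 2) {C : Finset (Fin n → Bool)}
    (hC : 1 < C.card) : (p / 2) ^ n ≤ PeCode n p C := by
  obtain ⟨c, hc⟩ : C.Nonempty := card_pos.mp (by omega)
  refine le_csInf ⟨_, fun _ => c, fun _ => hc, rfl⟩ ?_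
  rintro _ ⟨dec, -, rfl⟩
  obtain ⟨x, hx, hne⟩ := exists_mem_ne hC (dec c)
  have hnn := fun u v => bscProb_nonneg (n := n) hp0 (by linarith : p < 1) u v
  have h1 : p ^ n ≤ bscProb n p x c := by
    have hd : hammingDist x c ≤ n := by simpa using hammingDist_le_card_fintype (x := x) (y := c)
    calc p ^ n = p ^ hammingDist x c * p ^ (n - hammingDist x c) := by
          rw [← pow_add, Nat.add_sub_cancel' hd]
      _ ≤ _ := by
          unfold bscProb
          gcongr
          linarith
  have h2 : bscProb n p x c ≤ ∑ x ∈ C, ∑ y ∈ univ.filter (fun y => dec y ≠ x), bscProb n p x y := by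
    refine (single_le_sum (f := fun y => bscProb n p x y) (fun y _ => hnn x y) ?_).trans
      (single_le_sum (f := fun x => ∑ y ∈ univ.filter (fun y => dec y ≠ x), bscProb n p x y)
        (fun x _ => sum_nonneg fun y _ => hnn x y) hx)
    simpa using hne.symm
  have h3 : (C.card : ℝ) ≤ 2 ^ n := by
    have := card_le_univ C
    simp only [Fintype.card_pi, Fintype.card_bool, prod_const, card_univ, Fintype.card_fin] at this
    exact_mod_cast this
  have h4 : (0 : ℝ) < C.card := by exact_mod_cast (by omega : 0 < C.card)
  calc (p / 2) ^ n = (2 ^ n)⁻¹ * p ^ n := by rw [div_pow]; ring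
    _ ≤ (C.card : ℝ)⁻¹ * p ^ n := by gcongr
    _ ≤ _ := by
      gcongr
      exact h1.trans h2

lemma sum_rpow_le_rpow_sum {ι : Type*} (s : Finset ι) {f : ι → ℝ} (hf : ∀ i, 0 ≤ f i) {r : ℝ}
    (hr : 1 ≤ r) : ∑ i ∈ s, f i ^ r ≤ (∑ i ∈ s, f i) ^ r := by
  classical
  induction s using Finset.induction_on with
  | empty => simp [Real.zero_rpow (by linarith : r ≠ 0)]
  | insert a s ha ih =>
    rw [sum_insert ha, sum_insert ha]
    exact (add_le_add_right ih _).trans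
      (Real.add_rpow_le_rpow_add (hf a) (sum_nonneg fun i _ => hf i) hr)

lemma bscProb_le_bscProb {n : ℕ} {p : ℝ} (hp0 : 0 < p) (hp : p < 1 / 2) {x x' y : Fin n → Bool}
    (h : hammingDist x' y ≤ hammingDist x y) : bscProb n p x y ≤ bscProb n p x' y := by
  have hd : hammingDist x y ≤ n := by simpa using hammingDist_le_card_fintype (x := x) (y := y)
  obtain ⟨k, hk⟩ := Nat.exists_eq_add_of_le h
  have hk' : n - hammingDist x' y = k + (n - hammingDist x y) := by omega
  unfold bscProb
  rw [hk', pow_add, hk, pow_add, mul_assoc, ← hk]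
  have hq : 0 < 1 - p := by linarith
  gcongr
  linarith

/-- Gallager's random coding bound at a fixed block length. -/
lemma exists_code_PeCode_le {n : ℕ} {p : ℝ} (hp0 : 0 < p) (hp1 : p < 1) {M : ℕ} (hM0 : 0 < M)
    (hM : M ≤ 2 ^ n) {r l : ℝ} (hr0 : 0 ≤ r)
    (hr1 : r ≤ 1) (hl0 : 0 < l) (hl1 : l ≤ 1) :
    ∃ C : Finset (Fin n → Bool), C.card = M ∧
      PeCode n p C ≤ 2 * ((M / 2 ^ n * (1 + l) ^ n) ^ r * (1 - p + p * l ^ (-r)) ^ n) := by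
  have hM' : (0 : ℝ) < M := by exact_mod_cast hM0
  set K : ℝ := M / 2 ^ n * (1 + l) ^ n with hK
  have hK0 : 0 < K := by positivity
  set u : ℕ → ℝ := fun w => K * l⁻¹ ^ w with hu
  have hu0 : ∀ w, 0 < u w := fun w => by positivity
  set A : ℝ := K ^ r * (1 - p + p * l ^ (-r)) ^ n with hA
  have hnn := fun x y => bscProb_nonneg (n := n) hp0 hp1 x y
  have hPA : ∀ x : Fin n → Bool, ∑ y, bscProb n p x y * u (hammingDist x y) ^ r = A := by
    intro x
    have h : ∀ y, bscProb n p x y * u (hammingDist x y) ^ r =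
        K ^ r * ((p * l ^ (-r)) ^ hammingDist x y * (1 - p) ^ (n - hammingDist x y)) := by
      intro y
      have : (l⁻¹ ^ hammingDist x y) ^ r = (l ^ (-r)) ^ hammingDist x y := by
        rw [← Real.rpow_natCast, ← Real.rpow_natCast, Real.inv_rpow hl0.le, ← Real.rpow_neg hl0.le,
          ← Real.rpow_mul hl0.le, ← Real.rpow_mul hl0.le]
        ring_nf
      simp only [hu]
      rw [Real.mul_rpow hK0.le (by positivity), this, bscProb, mul_pow]
      ring
    simp_rw [h]
    rw [← mul_sum, sum_pow_hammingDist_mul_pow, add_comm (p * _)]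
  let k : (Fin n → Bool) → (Fin n → Bool) → (Fin n → Bool) → ℝ := fun x x' y =>
    if u (hammingDist x y) < 1 then
      bscProb n p x y * l⁻¹ ^ hammingDist x y * l ^ hammingDist x' y else 0
  have hk0 : ∀ x x' y, 0 ≤ k x x' y := by
    intro x x' y
    have := hnn x y
    simp only [k]
    split_ifs <;> positivity
  let g : (Fin n → Bool) → (Fin n → Bool) → ℝ := fun x x' => if x = x' then 0 else ∑ y, k x x' y
  have hg0 : ∀ x x', 0 ≤ g x x' := by
    intro x x'
    simp only [g]
    split_ifs
    exacts [le_rfl, sum_nonneg fun y _ => hk0 x x' y]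
  have hgrow : ∀ x, ∑ x', g x x' ≤ 2 ^ n / M * A := by
    intro x
    calc ∑ x', g x x' ≤ ∑ x', ∑ y, k x x' y := by
          refine sum_le_sum fun x' _ => ?_
          simp only [g]
          split_ifs
          exacts [sum_nonneg fun y _ => hk0 x x' y, le_rfl]
      _ = ∑ y, ∑ x', k x x' y := sum_comm
      _ ≤ ∑ y, 2 ^ n / M * (bscProb n p x y * u (hammingDist x y) ^ r) := by
          refine sum_le_sum fun y _ => ?_
          have := hnn x y
          simp only [k]
          split_ifs with hlt
          · rw [← mul_sum, sum_pow_hammingDist]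
            calc _ = 2 ^ n / M * (bscProb n p x y * u (hammingDist x y)) := by
                  simp only [hu, hK]
                  field_simp
              _ ≤ _ := by
                  gcongr
                  simpa using Real.rpow_le_rpow_of_exponent_ge (hu0 _) hlt.le hr1
          · have := (hu0 (hammingDist x y)).le
            rw [sum_const_zero]
            positivity
      _ = 2 ^ n / M * A := by rw [← mul_sum, hPA]
  obtain ⟨C, -, hC, hle⟩ := exists_subset_sum_le g hg0 (fun x => if_pos rfl) univ M
    (by simpa using hM)
  refine ⟨C, hC, (PeCode_le hp0 hp1 (card_pos.mp (hC ▸ hM0))).trans ?_⟩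
  have hcard : ((univ : Finset (Fin n → Bool)).card : ℝ) = 2 ^ n := by simp
  have hT : ∑ x ∈ C, ∑ x' ∈ C, g x x' ≤ M * A := by
    have h2 : ∑ x, ∑ x', g x x' ≤ 2 ^ n * (2 ^ n / M * A) := by
      rw [← hcard, ← nsmul_eq_mul, hcard]
      exact sum_le_card_nsmul _ _ _ fun x _ => hgrow x
    rw [hcard] at hle
    have h3 : (0 : ℝ) < (2 ^ n) ^ 2 := by positivity
    refine le_of_mul_le_mul_right (hle.trans ?_) h3
    calc (M : ℝ) ^ 2 * ∑ x, ∑ x', g x x' ≤ (M : ℝ) ^ 2 * (2 ^ n * (2 ^ n / M * A)) := by gcongr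
      _ = M * A * (2 ^ n) ^ 2 := by field_simp
  have hpt : ∀ x ∈ C, ∑ y ∈ univ.filter
      (fun y => ∃ x' ∈ C, x' ≠ x ∧ hammingDist x' y ≤ hammingDist x y), bscProb n p x y
        ≤ A + ∑ x' ∈ C, g x x' := by
    intro x hx
    have hg' : ∑ x' ∈ C, g x x' = ∑ y, ∑ x' ∈ C.erase x, k x x' y := by
      rw [sum_comm, ← add_sum_erase C _ hx]
      simp only [g, if_true, zero_add]
      exact sum_congr rfl fun x' hx' => if_neg (ne_of_mem_erase hx').symm
    rw [hg', ← hPA x, ← sum_add_distrib, sum_filter]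
    refine sum_le_sum fun y _ => ?_
    have hP := hnn x y
    have hur := Real.rpow_nonneg (hu0 (hammingDist x y)).le r
    have hs : 0 ≤ ∑ x' ∈ C.erase x, k x x' y := sum_nonneg fun x' _ => hk0 x x' y
    split_ifs with hbad
    · rcases lt_or_ge (u (hammingDist x y)) 1 with hlt | hge
      · obtain ⟨x', hx', hne, hd⟩ := hbad
        have h1 : bscProb n p x y ≤ k x x' y := by
          simp only [k, if_pos hlt]
          rw [mul_assoc]
          refine le_mul_of_one_le_right hP ?_
          rw [inv_pow, ← div_eq_inv_mul, one_le_div (by positivity)]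
          exact pow_le_pow_of_le_one hl0.le hl1 hd
        have h2 := single_le_sum (f := fun x' => k x x' y) (fun x' _ => hk0 x x' y)
          (mem_erase.mpr ⟨hne, hx'⟩)
        have h3 := mul_nonneg hP hur
        linarith
      · have h1 := le_mul_of_one_le_right hP (Real.one_le_rpow hge hr0)
        linarith
    · positivity
  calc _ ≤ (C.card : ℝ)⁻¹ * ∑ x ∈ C, (A + ∑ x' ∈ C, g x x') := by
        gcongr with x hx
        exact hpt x hx
    _ ≤ (M : ℝ)⁻¹ * (M * A + M * A) := by
        rw [sum_add_distrib, sum_const, hC, nsmul_eq_mul]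
        gcongr
    _ = 2 * A := by field_simp; ring

/-- Gallager's expurgated bound at a fixed block length. -/
lemma exists_code_PeCode_le_expurgated {n : ℕ} {p : ℝ} (hp0 : 0 < p) (hp : p < 1 / 2) {M : ℕ}
    (hM0 : 0 < M) (hM : 2 * M ≤ 2 ^ n) {r z : ℝ} (hr1 : 1 ≤ r) (hz0 : 0 < z)
    (hz : z ^ r = 2 * √(p * (1 - p))) :
    ∃ C : Finset (Fin n → Bool), M ≤ C.card ∧
      PeCode n p C ≤ (4 * (M / 2 ^ n) * (1 + z) ^ n) ^ r := by
  have hp1 : p < 1 := by linarith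
  have hM' : (0 : ℝ) < M := by exact_mod_cast hM0
  have hnn := fun x y => bscProb_nonneg (n := n) hp0 hp1 x y
  set B : ℝ := 4 * (M / 2 ^ n) * (1 + z) ^ n with hB
  have hB0 : 0 < B := by positivity
  let g : (Fin n → Bool) → (Fin n → Bool) → ℝ :=
    fun x x' => if x = x' then 0 else z ^ hammingDist x x'
  have hg0 : ∀ x x', 0 ≤ g x x' := by
    intro x x'
    simp only [g]
    split_ifs <;> positivity
  have hgrow : ∀ x, ∑ x', g x x' ≤ (1 + z) ^ n := by
    intro x
    rw [← sum_pow_hammingDist z x]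
    refine sum_le_sum fun x' _ => ?_
    simp only [g]
    split_ifs
    exacts [by positivity, (hammingDist_comm x x' ▸ le_rfl)]
  obtain ⟨S, -, hS, hle⟩ := exists_subset_sum_le g hg0 (fun x => if_pos rfl) univ (2 * M)
    (by simpa using hM)
  have hcard : ((univ : Finset (Fin n → Bool)).card : ℝ) = 2 ^ n := by simp
  have hT : ∑ x ∈ S, ∑ x' ∈ S, g x x' ≤ M * B := by
    have h2 : ∑ x, ∑ x', g x x' ≤ 2 ^ n * (1 + z) ^ n := by
      rw [← hcard, ← nsmul_eq_mul]
      exact sum_le_card_nsmul _ _ _ fun x _ => hgrow x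
    rw [hcard] at hle
    have h3 : (0 : ℝ) < (2 ^ n) ^ 2 := by positivity
    refine le_of_mul_le_mul_right (hle.trans ?_) h3
    push_cast
    calc (2 * (M : ℝ)) ^ 2 * ∑ x, ∑ x', g x x' ≤ (2 * (M : ℝ)) ^ 2 * (2 ^ n * (1 + z) ^ n) := by
          gcongr
      _ = M * B * (2 ^ n) ^ 2 := by rw [hB]; field_simp; ring
  set C := S.filter fun x => ∑ x' ∈ S, g x x' ≤ B with hC
  have hCM : M ≤ C.card := by
    by_contra! hlt
    have h1 : (S.filter fun x => ¬ ∑ x' ∈ S, g x x' ≤ B).card * B ≤ M * B := by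
      refine le_trans ?_ (hT.trans' (sum_le_sum_of_subset_of_nonneg
        (filter_subset (fun x => ¬ ∑ x' ∈ S, g x x' ≤ B) S)
        fun x _ _ => sum_nonneg fun x' _ => hg0 x x'))
      rw [← nsmul_eq_mul]
      refine card_nsmul_le_sum _ _ _ fun x hx => ?_
      exact (not_le.mp (mem_filter.mp hx).2).le
    have h2 := le_of_mul_le_mul_right h1 hB0
    have h3 : (S.filter fun x => ¬ ∑ x' ∈ S, g x x' ≤ B).card ≤ M := by exact_mod_cast h2
    have h4 := card_filter_add_card_filter_not (s := S) (fun x => ∑ x' ∈ S, g x x' ≤ B)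
    rw [← hC] at h4
    omega
  have hC0 : 0 < C.card := by omega
  refine ⟨C, hCM, (PeCode_le hp0 hp1 (card_pos.mp hC0)).trans ?_⟩
  have hpt : ∀ x ∈ C, ∑ y ∈ univ.filter
      (fun y => ∃ x' ∈ C, x' ≠ x ∧ hammingDist x' y ≤ hammingDist x y), bscProb n p x y
        ≤ B ^ r := by
    intro x hx
    calc _ ≤ ∑ y, ∑ x' ∈ C.erase x, √(bscProb n p x y * bscProb n p x' y) := by
          rw [sum_filter]
          refine sum_le_sum fun y _ => ?_
          split_ifs with hbad
          · obtain ⟨x', hx', hne, hd⟩ := hbad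
            refine le_trans ?_ (single_le_sum
              (f := fun x' => √(bscProb n p x y * bscProb n p x' y))
              (fun x' _ => Real.sqrt_nonneg _) (mem_erase.mpr ⟨hne, hx'⟩))
            refine Real.le_sqrt_of_sq_le ?_
            rw [sq]
            exact mul_le_mul_of_nonneg_left (bscProb_le_bscProb hp0 hp hd) (hnn x y)
          · exact sum_nonneg fun x' _ => Real.sqrt_nonneg _
      _ = ∑ x' ∈ C.erase x, ∑ y, √(bscProb n p x y * bscProb n p x' y) := sum_comm
      _ = ∑ x' ∈ C.erase x, (z ^ hammingDist x x') ^ r := by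
          refine sum_congr rfl fun x' _ => ?_
          rw [sum_sqrt_bscProb hp0 hp1, ← hz, ← Real.rpow_natCast, ← Real.rpow_natCast,
            ← Real.rpow_mul hz0.le, ← Real.rpow_mul hz0.le, mul_comm]
      _ ≤ (∑ x' ∈ C.erase x, z ^ hammingDist x x') ^ r :=
          sum_rpow_le_rpow_sum _ (fun x' => by positivity) hr1
      _ ≤ B ^ r := by
          gcongr
          rw [hC, mem_filter] at hx
          refine le_trans ?_ hx.2
          calc ∑ x' ∈ C.erase x, z ^ hammingDist x x' = ∑ x' ∈ C.erase x, g x x' :=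
                sum_congr rfl fun x' hx' => (if_neg (ne_of_mem_erase hx').symm).symm
            _ ≤ _ := sum_le_sum_of_subset_of_nonneg
                ((erase_subset _ _).trans (filter_subset _ _)) fun x' _ _ => hg0 x x'
  calc _ ≤ (C.card : ℝ)⁻¹ * ∑ x ∈ C, B ^ r := by
        gcongr with x hx
        exact hpt x hx
    _ = B ^ r := by
        rw [sum_const, nsmul_eq_mul]
        have : (C.card : ℝ) ≠ 0 := by positivity
        field_simp
lemma binEnt_eq (x : ℝ) : binEnt x = Real.binEntropy x / Real.log 2 := by
  unfold binEnt Real.binEntropy Real.logb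
  rw [Real.log_inv, Real.log_inv]
  ring

lemma strictMonoOn_binEnt : StrictMonoOn binEnt (Set.Icc 0 (1 / 2)) := by
  intro x hx y hy hxy
  rw [one_div] at hx hy
  rw [binEnt_eq, binEnt_eq]
  exact div_lt_div_of_pos_right (Real.binEntropy_strictMonoOn hx hy hxy) (Real.log_pos one_lt_two)

lemma binEnt_zero : binEnt 0 = 0 := by simp [binEnt]

lemma binEnt_one_half : binEnt (1 / 2) = 1 := by
  rw [binEnt_eq, one_div, Real.binEntropy_two_inv, div_self (Real.log_pos one_lt_two).ne']

lemma deltaGV_spec {R : ℝ} (hR0 : 0 < R) (hR1 : R < 1) :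
    0 < deltaGV R ∧ deltaGV R < 1 / 2 ∧ binEnt (deltaGV R) = 1 - R := by
  have hcont : Continuous binEnt := by
    rw [show binEnt = fun x => Real.binEntropy x / Real.log 2 from funext binEnt_eq]
    exact Real.binEntropy_continuous.div_const _
  obtain ⟨x, hx, hxR⟩ := intermediate_value_Icc (by norm_num : (0 : ℝ) ≤ 1 / 2) hcont.continuousOn
    (show 1 - R ∈ Set.Icc (binEnt 0) (binEnt (1 / 2)) by
      rw [binEnt_zero, binEnt_one_half]; constructor <;> linarith)
  have hset : {x : ℝ | x ∈ Set.Icc (0 : ℝ) (1 / 2) ∧ binEnt x = 1 - R} = {x} := by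
    ext y
    simp only [Set.mem_ofPred_eq, Set.mem_singleton_iff]
    refine ⟨fun hy => strictMonoOn_binEnt.injOn hy.1 hx (hy.2.trans hxR.symm), ?_⟩
    rintro rfl
    exact ⟨hx, hxR⟩
  have hd : deltaGV R = x := by rw [deltaGV, binEntInv, hset, csInf_singleton]
  rw [hd]
  refine ⟨hx.1.lt_of_ne ?_, hx.2.lt_of_ne ?_, hxR⟩
  · rintro rfl
    rw [binEnt_zero] at hxR
    linarith
  · rintro rfl
    rw [binEnt_one_half] at hxR
    linarith

/-- Codes whose error probability decays like `2 ^ (-E n)` witness `E` as an achievable exponent. -/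
lemma le_reliability_of_codes {p R E K : ℝ} (hp0 : 0 < p) (hp : p < 1 / 2) (hR0 : 0 < R)
    (hR1 : R ≤ 1) (hK : 0 < K)
    (h : ∀ᶠ n : ℕ in atTop, ∃ C : Finset (Fin n → Bool), (2 : ℝ) ^ (R * n) ≤ (C.card : ℝ) ∧
      PeCode n p C ≤ K * (2 ^ (-E)) ^ n) :
    E ≤ reliability p R
    ∧ ∃ Cn : (n : ℕ) → Finset (Fin n → Bool),
        (∀ n : ℕ, (2 : ℝ) ^ (R * n) ≤ ((Cn n).card : ℝ))
        ∧ E ≤ liminf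
            (fun n : ℕ => (n : ℝ)⁻¹ * Real.logb 2 (1 / PeCode n p (Cn n))) atTop := by
  have hex : ∀ n : ℕ, ∃ C : Finset (Fin n → Bool), (2 : ℝ) ^ (R * n) ≤ (C.card : ℝ) ∧
      ((∃ C : Finset (Fin n → Bool), (2 : ℝ) ^ (R * n) ≤ (C.card : ℝ) ∧
      PeCode n p C ≤ K * (2 ^ (-E)) ^ n) → PeCode n p C ≤ K * (2 ^ (-E)) ^ n) := by
    intro n
    by_cases hn : ∃ C : Finset (Fin n → Bool), (2 : ℝ) ^ (R * n) ≤ (C.card : ℝ) ∧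
      PeCode n p C ≤ K * (2 ^ (-E)) ^ n
    · obtain ⟨C, hC⟩ := hn
      exact ⟨C, hC.1, fun _ => hC.2⟩
    · refine ⟨univ, ?_, fun h => absurd h hn⟩
      have : ((univ : Finset (Fin n → Bool)).card : ℝ) = 2 ^ (n : ℝ) := by simp
      rw [this]
      gcongr
      · norm_num
      · nlinarith [n.cast_nonneg (α := ℝ)]
  choose Cn hCn hCn' using hex
  set f : ℕ → ℝ := fun n => (n : ℝ)⁻¹ * Real.logb 2 (1 / PeCode n p (Cn n)) with hf
  have hcard : ∀ n : ℕ, 0 < n → ∀ C : Finset (Fin n → Bool), (2 : ℝ) ^ (R * n) ≤ (C.card : ℝ) →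
      1 < C.card := by
    intro n hn C hC
    have h1 : (1 : ℝ) < 2 ^ (R * n) := Real.one_lt_rpow one_lt_two (by positivity)
    exact_mod_cast h1.trans_le hC
  have hub : ∀ n : ℕ, 0 < n → ∀ C : Finset (Fin n → Bool), (2 : ℝ) ^ (R * n) ≤ (C.card : ℝ) →
      (n : ℝ)⁻¹ * Real.logb 2 (1 / PeCode n p C) ≤ - Real.logb 2 (p / 2) := by
    intro n hn C hC
    have h1 := le_PeCode hp0 hp (hcard n hn C hC)
    have h2 : (0 : ℝ) < (p / 2) ^ n := by positivity
    have hn' : (0 : ℝ) < n := by exact_mod_cast hn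
    rw [inv_mul_le_iff₀ hn', one_div, Real.logb_inv]
    have h3 := Real.logb_le_logb_of_le one_lt_two h2 h1
    rw [Real.logb_pow] at h3
    linarith
  have hlb : ∀ᶠ n : ℕ in atTop, E - (n : ℝ)⁻¹ * Real.logb 2 K ≤ f n := by
    filter_upwards [h, eventually_gt_atTop 0] with n hn hn0
    have h1 := hCn' n hn
    have h2 : 0 < PeCode n p (Cn n) :=
      lt_of_lt_of_le (by positivity) (le_PeCode hp0 hp (hcard n hn0 _ (hCn n)))
    have hn' : (0 : ℝ) < n := by exact_mod_cast hn0
    have h3 := Real.logb_le_logb_of_le one_lt_two h2 h1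
    rw [Real.logb_mul hK.ne' (by positivity), Real.logb_pow, Real.logb_rpow two_pos (by norm_num)]
      at h3
    simp only [hf]
    rw [one_div, Real.logb_inv]
    calc E - (n : ℝ)⁻¹ * Real.logb 2 K = (n : ℝ)⁻¹ * (-(Real.logb 2 K + n * -E)) := by
          field_simp; ring
      _ ≤ _ := by gcongr
  have hlim : Tendsto (fun n : ℕ => E - (n : ℝ)⁻¹ * Real.logb 2 K) atTop (nhds E) := by
    have := (tendsto_inv_atTop_nhds_zero_nat (𝕜 := ℝ)).mul_const (Real.logb 2 K)
    simpa using this.const_sub E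
  have hfub : ∀ᶠ n in atTop, f n ≤ - Real.logb 2 (p / 2) := by
    filter_upwards [eventually_gt_atTop 0] with n hn using hub n hn _ (hCn n)
  have hfb : IsBoundedUnder (· ≤ ·) atTop f := ⟨_, hfub⟩
  have hfinf : E ≤ liminf f atTop := by
    refine hlim.liminf_eq.symm.trans_le ?_
    exact liminf_le_liminf hlb hlim.isBoundedUnder_ge hfb.isCoboundedUnder_ge
  refine ⟨hfinf.trans ?_, Cn, hCn, hfinf⟩
  unfold reliability
  set s : ℕ → ℝ := fun n => sSup {e : ℝ | ∃ C : Finset (Fin n → Bool),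
      (2 : ℝ) ^ (R * n) ≤ (C.card : ℝ) ∧
      e = (n : ℝ)⁻¹ * Real.logb 2 (1 / PeCode n p C)}
  have hsub : ∀ᶠ n in atTop, s n ≤ - Real.logb 2 (p / 2) := by
    filter_upwards [eventually_gt_atTop 0] with n hn
    refine csSup_le ⟨_, Cn n, hCn n, rfl⟩ ?_
    rintro _ ⟨C, hC, rfl⟩
    exact hub n hn C hC
  have hfs : ∀ᶠ n in atTop, f n ≤ s n := by
    filter_upwards [eventually_gt_atTop 0] with n hn
    refine le_csSup ⟨- Real.logb 2 (p / 2), ?_⟩ ⟨Cn n, hCn n, rfl⟩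
    rintro _ ⟨C, hC, rfl⟩
    exact hub n hn C hC
  have hfbelow : IsBoundedUnder (· ≥ ·) atTop f := hlim.isBoundedUnder_ge.mono_ge hlb
  calc liminf f atTop ≤ limsup f atTop := liminf_le_limsup hfb hfbelow
    _ ≤ limsup s atTop := limsup_le_limsup hfs hfbelow.isCoboundedUnder_le ⟨_, hsub⟩
lemma natCeil_rpow_le {R : ℝ} (hR0 : 0 < R) (n : ℕ) :
    (⌈(2 : ℝ) ^ (R * n)⌉₊ : ℝ) ≤ 2 * (2 ^ R) ^ n := by
  have h1 : (1 : ℝ) ≤ 2 ^ (R * n) := Real.one_le_rpow one_le_two (by positivity)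
  have h2 := (Nat.ceil_lt_add_one (by positivity : (0 : ℝ) ≤ 2 ^ (R * n))).le
  rw [← Real.rpow_natCast, ← Real.rpow_mul two_pos.le]
  linarith

/-- The exponent attained by the random coding bound with parameter `r` related to `d` by
`(d / (1 - d)) ^ (1 + r) = p / (1 - p)`. -/
lemma exists_code_of_tilt {p R d r : ℝ} (hp0 : 0 < p) (hp : p < 1 / 2) (hR0 : 0 < R) (hR1 : R ≤ 1)
    (hd0 : 0 < d) (hd : d ≤ 1 / 2) (hr0 : 0 ≤ r) (hr1 : r ≤ 1)
    (hr : (1 + r) * (Real.logb 2 d - Real.logb 2 (1 - d)) = Real.logb 2 p - Real.logb 2 (1 - p))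
    (n : ℕ) :
    ∃ C : Finset (Fin n → Bool), (2 : ℝ) ^ (R * n) ≤ (C.card : ℝ) ∧
      PeCode n p C ≤ 4 * (2 ^ (-(binKL d p + r * (1 - R - binEnt d)))) ^ n := by
  have hd1 : 0 < 1 - d := by linarith
  have hp1 : 0 < 1 - p := by linarith
  set M := ⌈(2 : ℝ) ^ (R * n)⌉₊
  set l : ℝ := d / (1 - d) with hl
  have hl0 : 0 < l := by positivity
  have hl1 : l ≤ 1 := by rw [hl, div_le_one hd1]; linarith
  have hM0 : 0 < M := Nat.ceil_pos.mpr (by positivity)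
  have hM2 : M ≤ 2 ^ n := by
    refine Nat.ceil_le.mpr ?_
    push_cast
    rw [← Real.rpow_natCast]
    gcongr
    · norm_num
    · nlinarith [n.cast_nonneg (α := ℝ)]
  obtain ⟨C, hC, hPe⟩ := exists_code_PeCode_le hp0 (by linarith) hM0 hM2 hr0 hr1 hl0 hl1
  refine ⟨C, hC ▸ Nat.le_ceil _, hPe.trans ?_⟩
  have hlr : 1 - p + p * l ^ (-r) = (1 - p) / (1 - d) := by
    have h1 : l ^ (1 + r) = p / (1 - p) := by
      refine Real.logb_injOn_pos one_lt_two (Set.mem_Ioi.mpr (by positivity))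
        (Set.mem_Ioi.mpr (by positivity)) ?_
      rw [Real.logb_rpow_eq_mul_logb_of_pos hl0, hl, Real.logb_div hd0.ne' hd1.ne',
        Real.logb_div hp0.ne' hp1.ne', hr]
    have h2 : l ^ (-r) = l / l ^ (1 + r) := by
      rw [eq_div_iff (by positivity), ← Real.rpow_add hl0, neg_add_cancel_comm_assoc, Real.rpow_one]
    rw [h2, h1, hl]
    field_simp
    ring
  have h1l : 1 + l = (1 - d)⁻¹ := by rw [hl]; field_simp; ring
  have hq : (2 ^ R / 2 * (1 + l)) ^ r * (1 - p + p * l ^ (-r))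
      = 2 ^ (-(binKL d p + r * (1 - R - binEnt d))) := by
    have hpos : (0 : ℝ) < 2 ^ R / 2 * (1 - d)⁻¹ := by positivity
    rw [hlr, h1l]
    refine Real.logb_injOn_pos one_lt_two (Set.mem_Ioi.mpr (by positivity))
        (Set.mem_Ioi.mpr (by positivity)) ?_
    rw [Real.logb_mul (by positivity) (by positivity), Real.logb_rpow_eq_mul_logb_of_pos hpos,
      Real.logb_mul (by positivity) (by positivity), Real.logb_div (by positivity) two_ne_zero,
      Real.logb_div (by positivity) (by positivity), Real.logb_inv,
      Real.logb_rpow two_pos (by norm_num), Real.logb_rpow two_pos (by norm_num),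
      Real.logb_self_eq_one one_lt_two, binKL, binEnt, Real.logb_div hd0.ne' hp0.ne',
      Real.logb_div hd1.ne' hp1.ne']
    linear_combination d * hr
  rw [← hq, mul_pow]
  have h2 : ((M : ℝ) / 2 ^ n * (1 + l) ^ n) ^ r ≤ 2 * ((2 ^ R / 2 * (1 + l)) ^ r) ^ n := by
    calc ((M : ℝ) / 2 ^ n * (1 + l) ^ n) ^ r
        ≤ (2 * (2 ^ R / 2 * (1 + l)) ^ n) ^ r := by
          refine Real.rpow_le_rpow (by positivity) ?_ hr0
          calc (M : ℝ) / 2 ^ n * (1 + l) ^ n ≤ 2 * (2 ^ R) ^ n / 2 ^ n * (1 + l) ^ n := by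
                gcongr
                exact natCeil_rpow_le hR0 n
            _ = _ := by rw [mul_pow, div_pow]; ring
      _ = 2 ^ r * ((2 ^ R / 2 * (1 + l)) ^ r) ^ n := by
          rw [Real.mul_rpow two_pos.le (by positivity), ← Real.rpow_pow_comm (by positivity)]
      _ ≤ _ := by
          gcongr
          simpa using Real.rpow_le_rpow_of_exponent_le one_le_two hr1
  have h3 : 0 ≤ (1 - p + p * l ^ (-r)) ^ n := by positivity
  nlinarith [mul_le_mul_of_nonneg_right h2 h3]

/-- The exponent attained by the expurgated bound with parameter `r` related to `d` by
`(d / (1 - d)) ^ r = 2√(p(1 - p))`. -/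
lemma exists_code_of_tilt_expurgated {p R d r : ℝ} (hp0 : 0 < p) (hp : p < 1 / 2) (hR0 : 0 < R)
    (hR1 : R < 1) (hd0 : 0 < d) (hd : d ≤ 1 / 2) (hdR : binEnt d = 1 - R) (hr1 : 1 ≤ r)
    (hr : r * (Real.logb 2 d - Real.logb 2 (1 - d)) = Real.logb 2 (2 * √(p * (1 - p)))) :
    ∀ᶠ n : ℕ in atTop, ∃ C : Finset (Fin n → Bool), (2 : ℝ) ^ (R * n) ≤ (C.card : ℝ) ∧
      PeCode n p C ≤ 8 ^ r * (2 ^ (-(-d * Real.logb 2 (2 * √(p * (1 - p)))))) ^ n := by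
  have hd1 : 0 < 1 - d := by linarith
  have hp1 : 0 < 1 - p := by linarith
  set z : ℝ := d / (1 - d) with hz
  have hz0 : 0 < z := by positivity
  have hzr : z ^ r = 2 * √(p * (1 - p)) := by
    refine Real.logb_injOn_pos one_lt_two (Set.mem_Ioi.mpr (by positivity))
      (Set.mem_Ioi.mpr (by positivity)) ?_
    rw [Real.logb_rpow_eq_mul_logb_of_pos hz0, hz, Real.logb_div hd0.ne' hd1.ne', hr]
  have h1z : 1 + z = (1 - d)⁻¹ := by rw [hz]; field_simp; ring
  have hq : (2 ^ R / 2 * (1 + z)) ^ r = 2 ^ (-(-d * Real.logb 2 (2 * √(p * (1 - p))))) := by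
    have hpos : (0 : ℝ) < 2 ^ R / 2 * (1 - d)⁻¹ := by positivity
    rw [h1z]
    refine Real.logb_injOn_pos one_lt_two (Set.mem_Ioi.mpr (by positivity))
        (Set.mem_Ioi.mpr (by positivity)) ?_
    rw [Real.logb_rpow_eq_mul_logb_of_pos hpos,
      Real.logb_mul (by positivity) (by positivity), Real.logb_div (by positivity) two_ne_zero,
      Real.logb_inv, Real.logb_rpow two_pos (by norm_num), Real.logb_rpow two_pos (by norm_num),
      Real.logb_self_eq_one one_lt_two]
    rw [binEnt] at hdR
    linear_combination d * hr + r * hdR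
  have hlarge : ∀ᶠ n : ℕ in atTop, 4 ≤ ((2 : ℝ) ^ (1 - R)) ^ n :=
    (tendsto_pow_atTop_atTop_of_one_lt
      (Real.one_lt_rpow one_lt_two (by linarith))).eventually_ge_atTop 4
  filter_upwards [hlarge] with n hn
  set M := ⌈(2 : ℝ) ^ (R * n)⌉₊ with hMdef
  have hM := natCeil_rpow_le hR0 n
  rw [← hMdef] at hM
  have hM0 : 0 < M := Nat.ceil_pos.mpr (by positivity)
  have hM2 : 2 * M ≤ 2 ^ n := by
    have h2 : (2 * M : ℝ) ≤ 2 ^ n := by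
      calc (2 * M : ℝ) ≤ 4 * (2 ^ R) ^ n := by linarith
        _ ≤ ((2 : ℝ) ^ (1 - R)) ^ n * (2 ^ R) ^ n := by gcongr
        _ = 2 ^ n := by rw [← mul_pow, ← Real.rpow_add two_pos]; simp
    exact_mod_cast h2
  obtain ⟨C, hC, hPe⟩ := exists_code_PeCode_le_expurgated hp0 hp hM0 hM2 hr1 hz0 hzr
  refine ⟨C, (Nat.le_ceil _).trans (by exact_mod_cast hC), hPe.trans ?_⟩
  calc (4 * ((M : ℝ) / 2 ^ n) * (1 + z) ^ n) ^ r
      ≤ (8 * (2 ^ R / 2 * (1 + z)) ^ n) ^ r := by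
        refine Real.rpow_le_rpow (by positivity) ?_ (by positivity)
        calc 4 * ((M : ℝ) / 2 ^ n) * (1 + z) ^ n
            ≤ 4 * (2 * (2 ^ R) ^ n / 2 ^ n) * (1 + z) ^ n := by gcongr
          _ = _ := by rw [mul_pow, div_pow]; ring
    _ = _ := by
        rw [Real.mul_rpow (by norm_num) (by positivity), ← Real.rpow_pow_comm (by positivity), hq]

lemma rho0_pos {p : ℝ} (hp0 : 0 < p) : 0 < rho0 p := by
  unfold rho0
  positivity

lemma rho0_lt_half {p : ℝ} (hp0 : 0 < p) (hp : p < 1 / 2) : rho0 p < 1 / 2 := by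
  have h1 : 0 < √p := Real.sqrt_pos.mpr hp0
  have h2 : √p < √(1 - p) := Real.sqrt_lt_sqrt hp0.le (by linarith)
  rw [rho0, div_lt_iff₀ (by positivity)]
  linarith

lemma one_sub_rho0 {p : ℝ} (hp0 : 0 < p) : 1 - rho0 p = √(1 - p) / (√p + √(1 - p)) := by
  have h1 : 0 < √p := Real.sqrt_pos.mpr hp0
  rw [rho0]
  field_simp
  ring

lemma logb_rho0_sub {p : ℝ} (hp0 : 0 < p) (hp : p < 1 / 2) :
    2 * (Real.logb 2 (rho0 p) - Real.logb 2 (1 - rho0 p)) = Real.logb 2 p - Real.logb 2 (1 - p) := by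
  have h1 : 0 < √p := Real.sqrt_pos.mpr hp0
  have h2 : 0 < √(1 - p) := Real.sqrt_pos.mpr (by linarith)
  rw [one_sub_rho0 hp0, rho0, Real.logb_div h1.ne' (by positivity),
    Real.logb_div h2.ne' (by positivity)]
  simp only [Real.logb, Real.log_sqrt hp0.le, Real.log_sqrt (by linarith : 0 ≤ 1 - p)]
  ring

lemma logb_omega0_sub {p : ℝ} (hp0 : 0 < p) (hp : p < 1 / 2) :
    Real.logb 2 (omega0 p) - Real.logb 2 (1 - omega0 p) = Real.logb 2 (2 * √(p * (1 - p))) := by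
  have hq : 0 < 1 - p := by linarith
  have h1 : 0 < √p := Real.sqrt_pos.mpr hp0
  have h2 : 0 < √(1 - p) := Real.sqrt_pos.mpr hq
  have e1 : √p ^ 2 = p := Real.sq_sqrt hp0.le
  have e2 : √(1 - p) ^ 2 = 1 - p := Real.sq_sqrt hq.le
  have hw : omega0 p = 2 * (√p * √(1 - p)) / (√p + √(1 - p)) ^ 2 := by
    rw [omega0, one_sub_rho0 hp0, rho0]
    field_simp
  have hw1 : 1 - omega0 p = 1 / (√p + √(1 - p)) ^ 2 := by
    rw [hw]
    field_simp
    linear_combination e1 + e2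
  rw [hw1, hw, Real.sqrt_mul hp0.le, ← Real.logb_div (by positivity) (by positivity)]
  congr 1
  field_simp

lemma logb_sub_logb_one_sub_le {x y : ℝ} (hx : 0 < x) (hxy : x ≤ y) (hy : y < 1) :
    Real.logb 2 x - Real.logb 2 (1 - x) ≤ Real.logb 2 y - Real.logb 2 (1 - y) := by
  have h1 := Real.logb_le_logb_of_le one_lt_two hx hxy
  have h2 := Real.logb_le_logb_of_le one_lt_two (by linarith : 0 < 1 - y)
    (by linarith : 1 - y ≤ 1 - x)
  linarith

lemma logb_sub_logb_one_sub_neg {x : ℝ} (hx : 0 < x) (hx2 : x < 1 / 2) :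
    Real.logb 2 x - Real.logb 2 (1 - x) < 0 :=
  sub_neg.mpr (Real.logb_lt_logb one_lt_two hx (by linarith))

end RandomCoding

/-- **The random coding bound** (Elias, Gallager): for every rate
`R ∈ (0, 1 − h(p))`, the reliability function satisfies `E(R,p) ≥ E₀(R,p)`; that is,
there exists a sequence of codes `C_n ⊆ {0,1}ⁿ` with `|C_n| ≥ 2^{Rn}` and
`liminf (1/n) log₂(1/P_e(C_n,p)) ≥ E₀(R,p)`. -/
theorem random_coding_bound
    (p : ℝ) (hp0 : 0 < p) (hp : p < 1 / 2)
    (R : ℝ) (hR0 : 0 < R) (hR1 : R < 1 - binEnt p) :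
    E0 p R ≤ reliability p R
    ∧ ∃ Cn : (n : ℕ) → Finset (Fin n → Bool),
        (∀ n : ℕ, (2 : ℝ) ^ (R * n) ≤ ((Cn n).card : ℝ))
        ∧ E0 p R ≤ liminf
            (fun n : ℕ => (n : ℝ)⁻¹ * Real.logb 2 (1 / PeCode n p (Cn n))) atTop := by
  have hmono := RandomCoding.strictMonoOn_binEnt
  have hh0 : 0 ≤ binEnt p := by
    rw [← RandomCoding.binEnt_zero]
    exact hmono.monotoneOn ⟨le_rfl, by norm_num⟩ ⟨hp0.le, hp.le⟩ hp0.le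
  have hR2 : R < 1 := by linarith
  obtain ⟨hd0, hd, hdR⟩ := RandomCoding.deltaGV_spec hR0 hR2
  have hr0 := RandomCoding.rho0_pos hp0
  have hr := RandomCoding.rho0_lt_half hp0 hp
  unfold E0
  split_ifs with hRx hRc
  · have hw0 : 0 < omega0 p := mul_pos (by linarith) (by linarith)
    have hw : omega0 p < 1 / 2 := by
      unfold omega0
      nlinarith [sq_pos_of_neg (by linarith : 2 * rho0 p - 1 < 0)]
    have hle : omega0 p ≤ deltaGV R := by
      refine (hmono.le_iff_le ⟨hw0.le, hw.le⟩ ⟨hd0.le, hd.le⟩).mp ?_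
      rw [hdR]
      unfold Rx at hRx
      linarith
    have h1 := RandomCoding.logb_sub_logb_one_sub_le hw0 hle (by linarith)
    have h2 := RandomCoding.logb_sub_logb_one_sub_neg hd0 hd
    rw [RandomCoding.logb_omega0_sub hp0 hp] at h1
    exact RandomCoding.le_reliability_of_codes hp0 hp hR0 hR2.le (by positivity)
      (RandomCoding.exists_code_of_tilt_expurgated hp0 hp hR0 hR2 hd0 hd.le hdR
        ((one_le_div_of_neg h2).mpr h1) (div_mul_cancel₀ _ h2.ne))
  · refine RandomCoding.le_reliability_of_codes hp0 hp hR0 hR2.le four_pos (.of_forall fun n => ?_)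
    have h := RandomCoding.exists_code_of_tilt hp0 hp hR0 hR2.le hr0 hr.le zero_le_one le_rfl
      (by rw [one_add_one_eq_two, RandomCoding.logb_rho0_sub hp0 hp]) n
    rwa [show binKL (rho0 p) p + 1 * (1 - R - binEnt (rho0 p)) = binKL (rho0 p) p + Rcrit p - R by
      unfold Rcrit; ring] at h
  · have hpd : p ≤ deltaGV R := by
      refine (hmono.le_iff_le ⟨hp0.le, hp.le⟩ ⟨hd0.le, hd.le⟩).mp ?_
      linarith
    have hdr : deltaGV R ≤ rho0 p := by
      refine (hmono.le_iff_le ⟨hd0.le, hd.le⟩ ⟨hr0.le, hr.le⟩).mp ?_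
      unfold Rcrit at hRc
      linarith
    have h1 := RandomCoding.logb_sub_logb_one_sub_le hp0 hpd (by linarith)
    have h2 := RandomCoding.logb_sub_logb_one_sub_neg hd0 hd
    have h3 := RandomCoding.logb_sub_logb_one_sub_le hd0 hdr (by linarith)
    have h4 := RandomCoding.logb_rho0_sub hp0 hp
    refine RandomCoding.le_reliability_of_codes hp0 hp hR0 hR2.le four_pos (.of_forall fun n => ?_)
    have h := RandomCoding.exists_code_of_tilt (r := (Real.logb 2 p - Real.logb 2 (1 - p)) /
        (Real.logb 2 (deltaGV R) - Real.logb 2 (1 - deltaGV R)) - 1) hp0 hp hR0 hR2.le hd0 hd.le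
      (sub_nonneg.mpr ((one_le_div_of_neg h2).mpr h1))
      (by rw [sub_le_iff_le_add, div_le_iff_of_neg h2]; linarith)
      (by rw [add_sub_cancel, div_mul_cancel₀ _ h2.ne]) n
    rwa [hdR, sub_self, mul_zero, add_zero] at h
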